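/- arXiv:2410.15727 — 2 statements merged into one kernel-verified Lean document; each statement's English description precedes it below -/
import Mathlib

section
/- There exists a constant C > 0 such that for every t ≥ 2 and every ball B = B(x₀,R) ⊂ ℝ² (x₀ ∈ ℝ², R > 0), one has ( (1/|B|) ∫_{B} min(t, φ(x)) dx ) · ( (1/|B|) ∫_{B} min(t, φ(x))^{-1} dx ) ≤ C; that is, the weights x ↦ min(t, φ(x)) belong to the Muckenhoupt A₂-class with A₂-constant bounded uniformly in t ≥ 2. -/
open MeasureTheory Real Filter
open scoped ENNReal RealInnerProductSpace

noncomputable def φ (x : EuclideanSpace ℝ (Fin 2)) : ℝ := Real.sqrt (‖x‖ ^ 2 + 1)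

noncomputable def ψ (t : ℝ) (x : EuclideanSpace ℝ (Fin 2)) : ℝ :=
  φ x * (1 - Real.exp (-t / φ x))

lemma continuous_φ : Continuous φ := by
  unfold φ
  fun_prop

lemma one_le_φ (x : EuclideanSpace ℝ (Fin 2)) : 1 ≤ φ x :=
  Real.one_le_sqrt.2 (by nlinarith [sq_nonneg ‖x‖])

lemma φ_le_norm_add_one (x : EuclideanSpace ℝ (Fin 2)) : φ x ≤ ‖x‖ + 1 :=
  Real.sqrt_le_iff.2 ⟨by positivity, by nlinarith [norm_nonneg x]⟩

lemma φ_le_two_mul {x y : EuclideanSpace ℝ (Fin 2)} (h : ‖x‖ ≤ 2 * ‖y‖) : φ x ≤ 2 * φ y := by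
  refine Real.sqrt_le_iff.2 ⟨by linarith [one_le_φ y], ?_⟩
  rw [mul_pow, φ, Real.sq_sqrt (by positivity)]
  nlinarith [norm_nonneg x]

lemma volume_real_ball_fin_two (x₀ : EuclideanSpace ℝ (Fin 2)) {R : ℝ} (hR : 0 < R) :
    volume.real (Metric.ball x₀ R) = Real.pi * R ^ 2 := by
  rw [Measure.real, EuclideanSpace.volume_ball_fin_two, ENNReal.toReal_mul, ENNReal.toReal_pow,
    ENNReal.toReal_ofReal hR.le]
  simp [mul_comm, Real.pi_pos.le]

lemma integrableOn_ball_of_continuous {f : EuclideanSpace ℝ (Fin 2) → ℝ} (hf : Continuous f)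
    (x₀ : EuclideanSpace ℝ (Fin 2)) (R : ℝ) : IntegrableOn f (Metric.ball x₀ R) :=
  (hf.continuousOn.integrableOn_compact (isCompact_closedBall x₀ R)).mono_set
    Metric.ball_subset_closedBall

lemma ball_average_le {f : EuclideanSpace ℝ (Fin 2) → ℝ} (hf : Continuous f)
    {x₀ : EuclideanSpace ℝ (Fin 2)} {R c : ℝ} (hR : 0 < R)
    (h : ∀ x ∈ Metric.ball x₀ R, f x ≤ c) :
    (Real.pi * R ^ 2)⁻¹ * ∫ x in Metric.ball x₀ R, f x ≤ c := by
  rw [inv_mul_le_iff₀ (by positivity)]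
  calc ∫ x in Metric.ball x₀ R, f x ≤ ∫ _ in Metric.ball x₀ R, c :=
        setIntegral_mono_on (integrableOn_ball_of_continuous hf x₀ R)
          (integrableOn_const measure_ball_lt_top.ne) measurableSet_ball h
    _ = Real.pi * R ^ 2 * c := by
        rw [setIntegral_const, volume_real_ball_fin_two x₀ hR, smul_eq_mul]

lemma integral_ball_zero_inv_φ_le {r : ℝ} (hr : 0 < r) :
    ∫ x in Metric.ball (0 : EuclideanSpace ℝ (Fin 2)) r, (φ x)⁻¹ ≤ 2 * Real.pi * r := by
  have key := integral_fun_norm_addHaar (volume : Measure (EuclideanSpace ℝ (Fin 2)))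
    ((Set.Iio r).indicator fun y : ℝ => (Real.sqrt (y ^ 2 + 1))⁻¹)
  have hl : ∫ x in Metric.ball (0 : EuclideanSpace ℝ (Fin 2)) r, (φ x)⁻¹ =
      ∫ x : EuclideanSpace ℝ (Fin 2),
        (Set.Iio r).indicator (fun y : ℝ => (Real.sqrt (y ^ 2 + 1))⁻¹) ‖x‖ := by
    rw [← integral_indicator measurableSet_ball]
    congr 1 with x
    simp [Set.indicator, φ]
  have hradial : ∫ y in Set.Ioi (0 : ℝ), y ^ (Module.finrank ℝ (EuclideanSpace ℝ (Fin 2)) - 1) •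
      (Set.Iio r).indicator (fun y : ℝ => (Real.sqrt (y ^ 2 + 1))⁻¹) y ≤ r := by
    have hle : ∀ y ∈ Set.Ioi (0 : ℝ), y ^ (Module.finrank ℝ (EuclideanSpace ℝ (Fin 2)) - 1) •
        (Set.Iio r).indicator (fun y : ℝ => (Real.sqrt (y ^ 2 + 1))⁻¹) y ≤
        (Set.Iio r).indicator (fun _ => (1 : ℝ)) y := by
      intro y hy
      by_cases hyr : y ∈ Set.Iio r
      · simp only [Set.indicator_of_mem hyr, finrank_euclideanSpace_fin, Nat.add_one_sub_one,
          pow_one, smul_eq_mul]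
        rw [← div_eq_mul_inv]
        exact (div_le_one (by positivity)).2 (Real.le_sqrt_of_sq_le (by linarith))
      · simp [Set.indicator_of_notMem hyr]
    have hnonneg : ∀ y ∈ Set.Ioi (0 : ℝ),
        0 ≤ y ^ (Module.finrank ℝ (EuclideanSpace ℝ (Fin 2)) - 1) •
        (Set.Iio r).indicator (fun y : ℝ => (Real.sqrt (y ^ 2 + 1))⁻¹) y := by
      intro y hy
      exact smul_nonneg (pow_nonneg (le_of_lt hy) _)
        (Set.indicator_nonneg (fun _ _ => by positivity) _)
    have hset : Set.Iio r ∩ Set.Ioi 0 = Set.Ioo 0 r := by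
      rw [Set.inter_comm, Set.Ioi_inter_Iio]
    have hint : IntegrableOn ((Set.Iio r).indicator fun _ => (1 : ℝ)) (Set.Ioi 0) := by
      rw [IntegrableOn, integrable_indicator_iff measurableSet_Iio, IntegrableOn,
        Measure.restrict_restrict measurableSet_Iio, hset]
      exact integrableOn_const measure_Ioo_lt_top.ne
    refine (integral_mono_of_nonneg ((ae_restrict_iff' measurableSet_Ioi).2 (.of_forall hnonneg))
      hint ((ae_restrict_iff' measurableSet_Ioi).2 (.of_forall hle))).trans_eq ?_
    rw [integral_indicator measurableSet_Iio, Measure.restrict_restrict measurableSet_Iio, hset]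
    simp [hr.le]
  rw [hl, key, volume_real_ball_fin_two 0 one_pos, finrank_euclideanSpace_fin]
  rw [finrank_euclideanSpace_fin] at hradial
  simp only [nsmul_eq_mul, smul_eq_mul] at hradial ⊢
  calc _ ≤ (2 : ℕ) * (Real.pi * 1 ^ 2 * r) := by gcongr
    _ = 2 * Real.pi * r := by push_cast; ring

/-- Uniform `A₂`-bound: there is `C > 0` such that for every `t ≥ 2` and every ball
`B(x₀,R) ⊂ ℝ²`, the product of the averages of `min(t, φ)` and of `min(t, φ)⁻¹` is
at most `C`; i.e. the weights `min(t, φ(·))` are `A₂` uniformly in `t ≥ 2`. -/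
theorem min_phi_A2_uniform :
    ∃ C > 0, ∀ t : ℝ, 2 ≤ t → ∀ x₀ : EuclideanSpace ℝ (Fin 2), ∀ R : ℝ, 0 < R →
      ((Real.pi * R ^ 2)⁻¹ * ∫ x in Metric.ball x₀ R, min t (φ x)) *
        ((Real.pi * R ^ 2)⁻¹ * ∫ x in Metric.ball x₀ R, (min t (φ x))⁻¹) ≤ C := by
  refine ⟨25, by norm_num, fun t ht x₀ R hR => ?_⟩
  have hone : ∀ x, 1 ≤ min t (φ x) := fun x => le_min (by linarith) (one_le_φ x)
  have hpos : ∀ x, 0 < min t (φ x) := fun x => one_pos.trans_le (hone x)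
  have hc : Continuous fun x => min t (φ x) := continuous_const.min continuous_φ
  have hci : Continuous fun x => (min t (φ x))⁻¹ := hc.inv₀ fun x => (hpos x).ne'
  have hA := fun c h => ball_average_le (x₀ := x₀) (c := c) hc hR h
  have hB := fun c h => ball_average_le (x₀ := x₀) (c := c) hci hR h
  have hB0 : 0 ≤ (Real.pi * R ^ 2)⁻¹ * ∫ x in Metric.ball x₀ R, (min t (φ x))⁻¹ :=
    mul_nonneg (by positivity) (integral_nonneg fun x => (inv_pos.2 (hpos x)).le)
  have hnorm : ∀ x ∈ Metric.ball x₀ R, ‖x‖ ≤ ‖x₀‖ + R ∧ ‖x₀‖ ≤ ‖x‖ + R := by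
    intro x hx
    rw [mem_ball_iff_norm] at hx
    constructor
    · linarith [norm_sub_norm_le x x₀]
    · linarith [norm_sub_norm_le x₀ x, norm_sub_rev x x₀]
  have hmin : ∀ x y, φ x ≤ 2 * φ y → min t (φ x) ≤ 2 * min t (φ y) := by
    intro x y h
    rw [mul_min_of_nonneg _ _ zero_le_two]
    exact min_le_min (by linarith) h
  rcases le_total (2 * R) ‖x₀‖ with hfar | hnear
  · have h1 := hA (2 * min t (φ x₀)) fun x hx =>
      hmin x x₀ (φ_le_two_mul (by linarith [(hnorm x hx).1]))
    have h2 := hB (2 * (min t (φ x₀))⁻¹) fun x hx => by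
      have := hmin x₀ x (φ_le_two_mul (by linarith [(hnorm x hx).2]))
      rw [← div_eq_mul_inv, le_div_iff₀ (hpos x₀), inv_mul_le_iff₀ (hpos x)]
      linarith
    refine (mul_le_mul h1 h2 hB0 (by linarith [hpos x₀])).trans ?_
    rw [mul_mul_mul_comm, mul_inv_cancel₀ (hpos x₀).ne']
    norm_num
  have hA1 := hA (3 * R + 1) fun x hx =>
    (min_le_right _ _).trans ((φ_le_norm_add_one x).trans (by linarith [(hnorm x hx).1]))
  rcases le_total R 1 with hR1 | hR1
  · have h2 := hB 1 fun x _ => inv_le_one_of_one_le₀ (hone x)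
    exact (mul_le_mul hA1 h2 hB0 (by positivity)).trans (by linarith)
  · have hA2 := hA t fun x _ => min_le_left _ _
    have hφi : Continuous fun x => (φ x)⁻¹ :=
      continuous_φ.inv₀ fun x => (one_pos.trans_le (one_le_φ x)).ne'
    have hle : ∫ x in Metric.ball x₀ R, (min t (φ x))⁻¹ ≤
        Real.pi * R ^ 2 * t⁻¹ + 2 * Real.pi * (3 * R) := by
      calc ∫ x in Metric.ball x₀ R, (min t (φ x))⁻¹
          ≤ ∫ x in Metric.ball x₀ R, (t⁻¹ + (φ x)⁻¹) := by
            refine setIntegral_mono_on (integrableOn_ball_of_continuous hci x₀ R)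
              (integrableOn_ball_of_continuous (continuous_const.add hφi) x₀ R)
              measurableSet_ball fun x _ => ?_
            have ht0 : 0 ≤ t⁻¹ := inv_nonneg.2 (by linarith)
            have hφ0 : 0 ≤ (φ x)⁻¹ := inv_nonneg.2 (by linarith [one_le_φ x])
            rcases min_choice t (φ x) with h | h <;> rw [h] <;> linarith
        _ = Real.pi * R ^ 2 * t⁻¹ + ∫ x in Metric.ball x₀ R, (φ x)⁻¹ := by
            rw [integral_add (integrableOn_ball_of_continuous continuous_const x₀ R)
              (integrableOn_ball_of_continuous hφi x₀ R), setIntegral_const,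
              volume_real_ball_fin_two x₀ hR, smul_eq_mul]
        _ ≤ Real.pi * R ^ 2 * t⁻¹ +
              ∫ x in Metric.ball (0 : EuclideanSpace ℝ (Fin 2)) (3 * R), (φ x)⁻¹ := by
            refine add_le_add le_rfl (setIntegral_mono_set (integrableOn_ball_of_continuous hφi 0 _)
              (.of_forall fun x => inv_nonneg.2 (by linarith [one_le_φ x]))
              (LE.le.eventuallyLE (Metric.ball_subset_ball' ?_)))
            rw [dist_zero_right]
            linarith
        _ ≤ _ := by
            gcongr
            exact integral_ball_zero_inv_φ_le (by positivity)
    have h2 : (Real.pi * R ^ 2)⁻¹ * ∫ x in Metric.ball x₀ R, (min t (φ x))⁻¹ ≤ t⁻¹ + 6 / R := by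
      rw [inv_mul_le_iff₀ (by positivity)]
      refine hle.trans_eq ?_
      field_simp
      ring
    have hA0 : 0 ≤ (Real.pi * R ^ 2)⁻¹ * ∫ x in Metric.ball x₀ R, min t (φ x) :=
      mul_nonneg (by positivity) (integral_nonneg fun x => (hpos x).le)
    refine (mul_le_mul_of_nonneg_left h2 hA0).trans ?_
    have h3 := mul_le_mul_of_nonneg_right hA2 (inv_nonneg.2 (by linarith : 0 ≤ t))
    rw [mul_inv_cancel₀ (by linarith : t ≠ 0)] at h3
    have h4 := mul_le_mul_of_nonneg_right (hA1.trans (by linarith : 3 * R + 1 ≤ 4 * R))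
      (by positivity : 0 ≤ 6 / R)
    have h5 : 4 * R * (6 / R) = 24 := by
      field_simp
      norm_num
    rw [mul_add]
    linarith
end

section
/- For every δ > 0 there exists a constant C = C(δ) > 0 such that for every t ≥ 0 and every smooth compactly supported vector field u : ℝ² → ℝ² with div u = 0, letting w := ∂₁u₂ − ∂₂u₁, one has | ∫_{ℝ²} ψ(t,x)² w(x) (u·∇w)(x) dx | ≤ δ ∫_{ℝ²} ψ(t,x)² w² dx + δ ∫_{ℝ²} ψ(t,x)² |∇w|² dx + C ( 1 + ( ∫_{ℝ²} w² dx )² + ( ∫_{ℝ²} |u|² dx )·( ∫_{ℝ²} |∇u|² dx ) ). -/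
open MeasureTheory Real Filter
open scoped ENNReal

/-- The partial derivative `∂ᵢ f` of a scalar function on `ℝ²`. -/
noncomputable def pd (i : Fin 2) (f : EuclideanSpace ℝ (Fin 2) → ℝ)
    (x : EuclideanSpace ℝ (Fin 2)) : ℝ :=
  fderiv ℝ f x (EuclideanSpace.single i 1)

/-- The vorticity (curl) of a planar vector field. -/
noncomputable def curl2 (u : EuclideanSpace ℝ (Fin 2) → EuclideanSpace ℝ (Fin 2))
    (x : EuclideanSpace ℝ (Fin 2)) : ℝ :=
  pd 0 (fun y => u y 1) x - pd 1 (fun y => u y 0) x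

local notation "E2" => EuclideanSpace ℝ (Fin 2)

theorem hasCompactSupport_pow {f : E2 → ℝ} (hf : HasCompactSupport f) {n : ℕ} (hn : n ≠ 0) :
    HasCompactSupport (fun x => f x ^ n) :=
  hf.comp_left (g := fun y : ℝ => y ^ n) (by simp [hn])

theorem sq_integral_mul_le {f g : E2 → ℝ} (hf : Continuous f) (hfc : HasCompactSupport f)
    (hg : Continuous g) (hgc : HasCompactSupport g) :
    (∫ x, f x * g x) ^ 2 ≤ (∫ x, f x ^ 2) * ∫ x, g x ^ 2 := by
  have hff : Integrable (fun x => f x ^ 2) :=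
    (Continuous.pow hf 2).integrable_of_hasCompactSupport (hasCompactSupport_pow hfc two_ne_zero)
  have hgg : Integrable (fun x => g x ^ 2) :=
    (Continuous.pow hg 2).integrable_of_hasCompactSupport (hasCompactSupport_pow hgc two_ne_zero)
  have hfg : Integrable (fun x => f x * g x) :=
    (hf.mul hg).integrable_of_hasCompactSupport hfc.mul_right
  have key : ∀ s : ℝ, 0 ≤ (∫ x, f x ^ 2) * (s * s) + (2 * ∫ x, f x * g x) * s
      + ∫ x, g x ^ 2 := by
    intro s
    have h : 0 ≤ ∫ x, (s * f x + g x) ^ 2 := integral_nonneg fun x => sq_nonneg _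
    have e : ∫ x, (s * f x + g x) ^ 2
        = ∫ x, ((s * s) * f x ^ 2 + (2 * s) * (f x * g x) + g x ^ 2) := by
      congr 1; ext x; ring
    have h1 := integral_add ((hff.const_mul (s * s)).add (hfg.const_mul (2 * s))) hgg
    have h2 := integral_add (hff.const_mul (s * s)) (hfg.const_mul (2 * s))
    simp only [Pi.add_apply] at h1
    rw [e, h1, h2, integral_const_mul, integral_const_mul] at h
    linarith
  have := discrim_le_zero key
  unfold discrim at this
  linarith

theorem continuous_pd {f : E2 → ℝ} (hf : ContDiff ℝ 1 f) (i : Fin 2) :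
    Continuous (pd i f) :=
  (hf.continuous_fderiv (by norm_num)).clm_apply continuous_const

theorem hasCompactSupport_pd {f : E2 → ℝ} (hfc : HasCompactSupport f) (i : Fin 2) :
    HasCompactSupport (pd i f) :=
  hfc.fderiv_apply ℝ _

theorem contDiff_pd {f : E2 → ℝ} (hf : ContDiff ℝ (⊤ : ℕ∞) f) (i : Fin 2) :
    ContDiff ℝ (⊤ : ℕ∞) (pd i f) :=
  (hf.fderiv_right (m := (⊤ : ℕ∞)) (by simp)).clm_apply contDiff_const

theorem integral_pd_eq_zero {f : E2 → ℝ} (hf : ContDiff ℝ 1 f) (hfc : HasCompactSupport f)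
    (i : Fin 2) : ∫ x, pd i f x = 0 := by
  have h := integral_mul_fderiv_eq_neg_fderiv_mul_of_integrable (μ := volume)
    (f := fun _ => (1 : ℝ)) (g := f) (v := EuclideanSpace.single i 1) (by simp)
    (by
      simp only [one_mul]
      exact (continuous_pd hf i).integrable_of_hasCompactSupport (hasCompactSupport_pd hfc i))
    (by simpa using hf.continuous.integrable_of_hasCompactSupport (μ := volume) hfc)
    (fun x _ => differentiableAt_const _)
    (fun x _ => hf.differentiable (by norm_num) x)
  simpa [pd] using h

theorem norm_fderiv_le_pd (f : E2 → ℝ) (x : E2) :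
    ‖fderiv ℝ f x‖ ≤ |pd 0 f x| + |pd 1 f x| := by
  refine ContinuousLinearMap.opNorm_le_bound _ (by positivity) fun v => ?_
  have hv : v = v 0 • EuclideanSpace.single 0 (1 : ℝ) + v 1 • EuclideanSpace.single 1 (1 : ℝ) := by
    ext i; fin_cases i <;> simp
  have e : fderiv ℝ f x v = v 0 * pd 0 f x + v 1 * pd 1 f x := by
    conv_lhs => rw [hv]
    simp [pd]
  have h0 : |v 0| ≤ ‖v‖ := PiLp.norm_apply_le v 0
  have h1 : |v 1| ≤ ‖v‖ := PiLp.norm_apply_le v 1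
  rw [e, Real.norm_eq_abs]
  refine (abs_add_le _ _).trans ?_
  rw [abs_mul, abs_mul]
  nlinarith [mul_le_mul_of_nonneg_right h0 (abs_nonneg (pd 0 f x)),
    mul_le_mul_of_nonneg_right h1 (abs_nonneg (pd 1 f x))]

theorem contDiff_φ : ContDiff ℝ (⊤ : ℕ∞) φ := by
  unfold φ
  exact ((contDiff_norm_sq ℝ).add contDiff_const).sqrt fun x => by positivity

theorem φ_pos (x : E2) : 0 < φ x := Real.sqrt_pos.2 (by positivity)

theorem contDiff_ψ (t : ℝ) : ContDiff ℝ (⊤ : ℕ∞) (ψ t) := by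
  unfold ψ
  exact contDiff_φ.mul (contDiff_const.sub
    ((contDiff_const.div contDiff_φ fun x => (φ_pos x).ne').exp))

theorem abs_pd_φ_le (i : Fin 2) (x : E2) : |pd i φ x| ≤ 1 := by
  have h : HasFDerivAt φ ((1 / (2 * √(‖x‖ ^ 2 + 1))) • (2 • innerSL ℝ x)) x := by
    have := ((hasStrictFDerivAt_norm_sq x).hasFDerivAt.add_const 1).sqrt (by positivity)
    exact this
  have e : pd i φ x = x i / φ x := by
    rw [pd, h.fderiv]
    have := φ_pos x
    simp only [φ] at this ⊢
    simp [EuclideanSpace.inner_single_right]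
    field_simp
  rw [e, abs_div, abs_of_pos (φ_pos x), div_le_one (φ_pos x)]
  refine (PiLp.norm_apply_le x i).trans (Real.le_sqrt_of_sq_le (by linarith))

theorem abs_pd_ψ_le {t : ℝ} (ht : 0 ≤ t) (i : Fin 2) (x : E2) : |pd i (ψ t) x| ≤ 1 := by
  have hp := φ_pos x
  have hφ : HasFDerivAt φ (fderiv ℝ φ x) x :=
    (contDiff_φ.differentiable (by simp) x).hasFDerivAt
  have hr : HasDerivAt (fun r : ℝ => r * (1 - Real.exp (-t / r)))
      (1 - Real.exp (-t / φ x) - (t / φ x) * Real.exp (-t / φ x)) (φ x) := by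
    have h1 := ((hasDerivAt_const (φ x) (-t)).div (hasDerivAt_id (φ x)) hp.ne').exp
    have := (hasDerivAt_id (φ x)).mul (h1.const_sub 1)
    refine this.congr_deriv ?_
    simp
    field_simp
    ring
  have hψ := hr.comp_hasFDerivAt x hφ
  have e : pd i (ψ t) x
      = (1 - Real.exp (-t / φ x) - (t / φ x) * Real.exp (-t / φ x)) * pd i φ x := by
    have : fderiv ℝ (ψ t) x = _ := hψ.fderiv
    rw [pd, this]; simp [pd]
  have hs : 0 ≤ t / φ x := by positivity
  rw [e, abs_mul]
  refine mul_le_one₀ ?_ (abs_nonneg _) (abs_pd_φ_le i x)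
  rw [neg_div]
  generalize t / φ x = s at hs
  have h1 : 0 < Real.exp (-s) := Real.exp_pos _
  have h2 : Real.exp (-s) * Real.exp s = 1 := by rw [← Real.exp_add]; simp
  have h3 := Real.add_one_le_exp s
  rw [abs_le]
  constructor <;> nlinarith [mul_le_mul_of_nonneg_left h3 h1.le, mul_nonneg hs h1.le]

theorem ladyzhenskaya : ∃ K : ℝ, 0 < K ∧ ∀ f : E2 → ℝ, ContDiff ℝ 1 f → HasCompactSupport f →
    ∫ x, f x ^ 4 ≤ K * (∫ x, f x ^ 2) * ∫ x, (pd 0 f x ^ 2 + pd 1 f x ^ 2) := by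
  have hp : Real.HolderConjugate (Module.finrank ℝ E2) 2 := by
    simpa using Real.HolderConjugate.two_two
  set c : ℝ := (lintegralPowLePowLIntegralFDerivConst (volume : Measure E2) 2 : ℝ)
  have hc0 : 0 ≤ c := NNReal.coe_nonneg _
  refine ⟨8 * c + 1, by positivity, fun f hf hfc => ?_⟩
  have hcont := hf.continuous
  have hp0 := continuous_pd hf 0
  have hp1 := continuous_pd hf 1
  have hsq : ContDiff ℝ 1 (fun x => f x ^ 2) := hf.pow 2
  have hsqc : HasCompactSupport (fun x => f x ^ 2) :=
    hasCompactSupport_pow hfc two_ne_zero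
  have h := lintegral_pow_le_pow_lintegral_fderiv (volume : Measure E2) hsq hsqc hp
  have hi4 : Integrable (fun x => f x ^ 4) := by
    have h4 : HasCompactSupport (fun x => f x ^ 4) :=
      hasCompactSupport_pow hfc four_ne_zero
    exact Continuous.integrable_of_hasCompactSupport (by fun_prop) h4
  have hiD : Integrable (fun x => ‖fderiv ℝ (fun x => f x ^ 2) x‖) :=
    ((hsq.continuous_fderiv (by norm_num)).integrable_of_hasCompactSupport (hsqc.fderiv ℝ)).norm
  have hl : ∫⁻ x, ‖f x ^ 2‖ₑ ^ (2 : ℝ) = ENNReal.ofReal (∫ x, f x ^ 4) := by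
    rw [ofReal_integral_eq_lintegral_ofReal hi4 (ae_of_all _ fun x => by positivity)]
    congr 1; ext x
    rw [← ofReal_norm, ENNReal.ofReal_rpow_of_nonneg (norm_nonneg _) (by norm_num)]
    congr 1
    rw [Real.norm_of_nonneg (by positivity)]
    norm_cast
    ring
  have hr : ∫⁻ x, ‖fderiv ℝ (fun x => f x ^ 2) x‖ₑ
      = ENNReal.ofReal (∫ x, ‖fderiv ℝ (fun x => f x ^ 2) x‖) := by
    rw [ofReal_integral_eq_lintegral_ofReal hiD (ae_of_all _ fun x => norm_nonneg _)]
    simp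
  have hD0 : 0 ≤ ∫ x, ‖fderiv ℝ (fun x => f x ^ 2) x‖ := integral_nonneg fun x => norm_nonneg _
  rw [hl, hr, ENNReal.ofReal_rpow_of_nonneg hD0 (by norm_num), ← ENNReal.ofReal_coe_nnreal,
    ← ENNReal.ofReal_mul (by positivity), ENNReal.ofReal_le_ofReal_iff (by positivity)] at h
  have hDle : ∫ x, ‖fderiv ℝ (fun x => f x ^ 2) x‖
      ≤ 2 * ∫ x, |f x| * (|pd 0 f x| + |pd 1 f x|) := by
    rw [← integral_const_mul]
    refine integral_mono hiD ?_ fun x => ?_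
    · exact (Continuous.integrable_of_hasCompactSupport (by fun_prop) hfc.norm.mul_right).const_mul _
    · have e : fderiv ℝ (fun x => f x ^ 2) x = (2 * f x) • fderiv ℝ f x := by
        rw [fderiv_fun_pow _ (hf.differentiable (by norm_num) x)]
        simp
      simp only [e, norm_smul, norm_mul, Real.norm_eq_abs, abs_two]
      have := norm_fderiv_le_pd f x
      rw [mul_assoc]
      gcongr
  have hCS := sq_integral_mul_le (f := fun x => |f x|) (g := fun x => |pd 0 f x| + |pd 1 f x|)
    (by fun_prop) hfc.norm (by fun_prop)
    ((hasCompactSupport_pd hfc 0).norm.add (hasCompactSupport_pd hfc 1).norm)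
  have hg : ∫ x, (|pd 0 f x| + |pd 1 f x|) ^ 2 ≤ 2 * ∫ x, (pd 0 f x ^ 2 + pd 1 f x ^ 2) := by
    rw [← integral_const_mul]
    have hs (i : Fin 2) : HasCompactSupport (fun x => pd i f x ^ 2) :=
      hasCompactSupport_pow (hasCompactSupport_pd hfc i) two_ne_zero
    refine integral_mono_of_nonneg (ae_of_all _ fun x => by positivity) ?_
      (ae_of_all _ fun x => ?_)
    · exact (Continuous.integrable_of_hasCompactSupport (by fun_prop)
        ((hs 0).add (hs 1))).const_mul _
    · have := sq_nonneg (|pd 0 f x| - |pd 1 f x|)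
      have := sq_abs (pd 0 f x)
      have := sq_abs (pd 1 f x)
      simp only
      nlinarith
  simp only [sq_abs] at hCS
  have hF : 0 ≤ ∫ x, f x ^ 2 := integral_nonneg fun x => by positivity
  have hG : 0 ≤ ∫ x, (pd 0 f x ^ 2 + pd 1 f x ^ 2) := integral_nonneg fun x => by positivity
  calc ∫ x, f x ^ 4 ≤ c * (∫ x, ‖fderiv ℝ (fun x => f x ^ 2) x‖) ^ 2 := by exact_mod_cast h
    _ ≤ c * (2 * ∫ x, |f x| * (|pd 0 f x| + |pd 1 f x|)) ^ 2 := by gcongr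
    _ = 4 * c * (∫ x, |f x| * (|pd 0 f x| + |pd 1 f x|)) ^ 2 := by ring
    _ ≤ 4 * c * ((∫ x, f x ^ 2) * (2 * ∫ x, (pd 0 f x ^ 2 + pd 1 f x ^ 2))) := by
      gcongr
      exact hCS.trans (by gcongr)
    _ ≤ _ := by nlinarith [mul_nonneg hF hG]

theorem pd_mul {f g : E2 → ℝ} (hf : ContDiff ℝ 1 f) (hg : ContDiff ℝ 1 g) (i : Fin 2) (x : E2) :
    pd i (fun x => f x * g x) x = f x * pd i g x + g x * pd i f x := by
  rw [pd, fderiv_fun_mul (hf.differentiable (by norm_num) x) (hg.differentiable (by norm_num) x)]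
  simp [pd]

theorem integral_weighted_convection {a w : E2 → ℝ} {v : Fin 2 → E2 → ℝ} (ha : ContDiff ℝ 1 a)
    (hw : ContDiff ℝ 1 w) (hwc : HasCompactSupport w) (hv : ∀ i, ContDiff ℝ 1 (v i))
    (hdiv : ∀ x, pd 0 (v 0) x + pd 1 (v 1) x = 0) :
    ∫ x, a x ^ 2 * w x * ∑ k : Fin 2, v k x * pd k w x
      = -∫ x, a x * w x ^ 2 * ∑ k : Fin 2, v k x * pd k a x := by
  have hq : ContDiff ℝ 1 (fun x => a x * w x) := ha.mul hw
  have hqc : HasCompactSupport (fun x => a x * w x) := hwc.mul_left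
  have hF (i : Fin 2) : ContDiff ℝ 1 (fun x => (a x * w x) * ((a x * w x) * v i x)) :=
    hq.mul (hq.mul (hv i))
  have hFc (i : Fin 2) : HasCompactSupport (fun x => (a x * w x) * ((a x * w x) * v i x)) :=
    hqc.mul_right
  have hFi (i : Fin 2) : Integrable (pd i (fun x => (a x * w x) * ((a x * w x) * v i x))) :=
    (continuous_pd (hF i) i).integrable_of_hasCompactSupport (hasCompactSupport_pd (hFc i) i)
  have hac := ha.continuous
  have hwcont := hw.continuous
  have hvc (i : Fin 2) := (hv i).continuous
  have hpa (i : Fin 2) := continuous_pd ha i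
  have hR : Integrable (fun x => a x * w x ^ 2 * ∑ k : Fin 2, v k x * pd k a x) :=
    Continuous.integrable_of_hasCompactSupport (by fun_prop)
      ((hasCompactSupport_pow hwc two_ne_zero).mul_left (f := a)).mul_right
  have key (x : E2) : a x ^ 2 * w x * ∑ k : Fin 2, v k x * pd k w x
      = (1 / 2) * (pd 0 (fun x => (a x * w x) * ((a x * w x) * v 0 x)) x
        + pd 1 (fun x => (a x * w x) * ((a x * w x) * v 1 x)) x)
        - a x * w x ^ 2 * ∑ k : Fin 2, v k x * pd k a x := by
    rw [pd_mul hq (hq.mul (hv 0)), pd_mul hq (hq.mul (hv 1)), pd_mul hq (hv 0), pd_mul hq (hv 1),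
      pd_mul ha hw, pd_mul ha hw, Fin.sum_univ_two, Fin.sum_univ_two]
    linear_combination (-(1 / 2) * (a x * w x) ^ 2) * hdiv x
  simp_rw [key]
  have hsub := integral_sub (((hFi 0).add (hFi 1)).const_mul (1 / 2)) hR
  have hadd := integral_add (hFi 0) (hFi 1)
  simp only [Pi.add_apply] at hsub
  rw [hsub, integral_const_mul, hadd, integral_pd_eq_zero (hF 0) (hFc 0),
    integral_pd_eq_zero (hF 1) (hFc 1)]
  simp

theorem abs_integral_weighted_convection_le {a w : E2 → ℝ} {v : Fin 2 → E2 → ℝ}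
    (ha : ContDiff ℝ 1 a) (ha1 : ∀ i x, |pd i a x| ≤ 1)
    (hw : ContDiff ℝ 1 w) (hwc : HasCompactSupport w) (hv : ∀ i, ContDiff ℝ 1 (v i))
    (hdiv : ∀ x, pd 0 (v 0) x + pd 1 (v 1) x = 0) :
    |∫ x, a x ^ 2 * w x * ∑ k : Fin 2, v k x * pd k w x|
      ≤ ∫ x, |w x| * (|a x * w x| * (|v 0 x| + |v 1 x|)) := by
  rw [integral_weighted_convection ha hw hwc hv hdiv, abs_neg, ← Real.norm_eq_abs]
  have hac := ha.continuous
  have hwcont := hw.continuous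
  have hvc (i : Fin 2) := (hv i).continuous
  refine norm_integral_le_of_norm_le (g := fun x => |w x| * (|a x * w x| * (|v 0 x| + |v 1 x|)))
    (Continuous.integrable_of_hasCompactSupport (μ := volume) (by fun_prop) hwc.norm.mul_right)
    (ae_of_all _ fun x => ?_)
  have h : |∑ k : Fin 2, v k x * pd k a x| ≤ |v 0 x| + |v 1 x| := by
    rw [Fin.sum_univ_two]
    refine (abs_add_le _ _).trans ?_
    rw [abs_mul, abs_mul]
    exact add_le_add (mul_le_of_le_one_right (abs_nonneg _) (ha1 0 x))
      (mul_le_of_le_one_right (abs_nonneg _) (ha1 1 x))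
  calc ‖a x * w x ^ 2 * ∑ k : Fin 2, v k x * pd k a x‖
      = |w x| * (|a x * w x| * |∑ k : Fin 2, v k x * pd k a x|) := by
        rw [Real.norm_eq_abs, abs_mul, abs_mul, abs_pow, abs_mul]; ring
    _ ≤ _ := by gcongr

theorem integral_abs_add_abs_pow_four_le {f g : E2 → ℝ} (hf : Continuous f)
    (hfc : HasCompactSupport f) (hg : Continuous g) (hgc : HasCompactSupport g) :
    ∫ x, (|f x| + |g x|) ^ 4 ≤ 8 * ((∫ x, f x ^ 4) + ∫ x, g x ^ 4) := by
  have hif : Integrable (fun x => f x ^ 4) :=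
    (Continuous.pow hf 4).integrable_of_hasCompactSupport (hasCompactSupport_pow hfc four_ne_zero)
  have hig : Integrable (fun x => g x ^ 4) :=
    (Continuous.pow hg 4).integrable_of_hasCompactSupport (hasCompactSupport_pow hgc four_ne_zero)
  rw [← integral_add hif hig, ← integral_const_mul]
  refine integral_mono_of_nonneg (ae_of_all _ fun x => by positivity)
    ((hif.add hig).const_mul _) (ae_of_all _ fun x => ?_)
  have h := add_pow_le (abs_nonneg (f x)) (abs_nonneg (g x)) 4
  simp only [Even.pow_abs (by decide : Even 4)] at h
  norm_num at h
  exact h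

theorem integral_sq_pd_mul_le {a w : E2 → ℝ} (ha : ContDiff ℝ 1 a) (ha1 : ∀ i x, |pd i a x| ≤ 1)
    (hw : ContDiff ℝ 1 w) (hwc : HasCompactSupport w) :
    ∫ x, (pd 0 (fun x => a x * w x) x ^ 2 + pd 1 (fun x => a x * w x) x ^ 2)
      ≤ 2 * (∫ x, a x ^ 2 * ∑ i : Fin 2, pd i w x ^ 2) + 4 * ∫ x, w x ^ 2 := by
  have hac := ha.continuous
  have hwcont := hw.continuous
  have hp (i : Fin 2) := continuous_pd hw i
  have hs (i : Fin 2) : HasCompactSupport (fun x => pd i w x ^ 2) :=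
    hasCompactSupport_pow (hasCompactSupport_pd hwc i) two_ne_zero
  have h1 : Integrable (fun x => a x ^ 2 * ∑ i : Fin 2, pd i w x ^ 2) := by
    refine Continuous.integrable_of_hasCompactSupport (by fun_prop) (HasCompactSupport.mul_left ?_)
    simp only [Fin.sum_univ_two]
    exact (hs 0).add (hs 1)
  have h2 : Integrable (fun x => w x ^ 2) :=
    Continuous.integrable_of_hasCompactSupport (by fun_prop) (hasCompactSupport_pow hwc two_ne_zero)
  rw [← integral_const_mul, ← integral_const_mul,
    ← integral_add (h1.const_mul 2) (h2.const_mul 4)]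
  refine integral_mono_of_nonneg (ae_of_all _ fun x => by positivity)
    ((h1.const_mul 2).add (h2.const_mul 4)) (ae_of_all _ fun x => ?_)
  have hb (i : Fin 2) : pd i (fun x => a x * w x) x ^ 2
      ≤ 2 * (a x ^ 2 * pd i w x ^ 2) + 2 * w x ^ 2 := by
    rw [pd_mul ha hw]
    have h3 : pd i a x ^ 2 ≤ 1 := (sq_le_one_iff_abs_le_one _).2 (ha1 i x)
    nlinarith [sq_nonneg (a x * pd i w x - w x * pd i a x),
      mul_le_mul_of_nonneg_left h3 (sq_nonneg (w x))]
  simp only [Fin.sum_univ_two]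
  linarith [hb 0, hb 1]

theorem le_of_pow_four_le {δ K I A B W D : ℝ} (hδ : 0 < δ) (hK : 0 < K) (hA : 0 ≤ A) (hB : 0 ≤ B)
    (hW : 0 ≤ W) (hD : 0 ≤ D)
    (h : I ^ 4 ≤ W ^ 2 * ((K * A * (2 * B + 4 * W)) * (8 * (K * D)))) :
    I ≤ δ * A + δ * B + (2 * δ + K / (2 * δ)) * (1 + W ^ 2 + D) := by
  set S := A + (2 * B + 4 * W)
  set T := W ^ 2 + D with hT
  have hS0 : 0 ≤ S := by positivity
  have hT0 : 0 ≤ T := by positivity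
  have h1 : 4 * (A * (2 * B + 4 * W)) ≤ S ^ 2 := by
    nlinarith [sq_nonneg (A - (2 * B + 4 * W))]
  have h2 : 4 * (W ^ 2 * D) ≤ T ^ 2 := by nlinarith [sq_nonneg (W ^ 2 - D)]
  have h3 : (I ^ 2) ^ 2 ≤ (K * S * T) ^ 2 := by
    have := mul_le_mul h1 h2 (by positivity) (by positivity)
    have := mul_le_mul_of_nonneg_left this (sq_nonneg K)
    nlinarith [mul_nonneg (sq_nonneg K) (mul_nonneg (sq_nonneg S) (sq_nonneg T))]
  have h4 : I ^ 2 ≤ K * S * T := abs_le_of_sq_le_sq' h3 (by positivity) |>.2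
  have h5 : I ≤ δ / 2 * S + K / (2 * δ) * T := by
    refine abs_le_of_sq_le_sq' (h4.trans ?_) (by positivity) |>.2
    have e : (δ / 2 * S + K / (2 * δ) * T) ^ 2
        = (δ / 2 * S - K / (2 * δ) * T) ^ 2 + K * S * T := by field_simp; ring
    rw [e]
    nlinarith [sq_nonneg (δ / 2 * S - K / (2 * δ) * T)]
  have h6 : δ / 2 * S ≤ δ * A + δ * B + 2 * δ * (1 + T) := by
    nlinarith [mul_nonneg hδ.le hA, mul_nonneg hδ.le (sq_nonneg (W - 1)), mul_nonneg hδ.le hD,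
      mul_nonneg hδ.le (sq_nonneg W)]
  have h7 : 0 < K / (2 * δ) := by positivity
  have e : (2 * δ + K / (2 * δ)) * (1 + W ^ 2 + D)
      = 2 * δ * (1 + T) + K / (2 * δ) * T + K / (2 * δ) := by rw [hT]; ring
  linarith

/-- Estimate for the weighted vorticity convection term: for every `δ > 0` there is
`C > 0` such that for all `t ≥ 0` and all smooth compactly supported divergence-free
`u : ℝ² → ℝ²` with vorticity `w`,
`|∫ ψ² w (u·∇w)| ≤ δ∫ψ²w² + δ∫ψ²|∇w|² + C(1 + (∫w²)² + (∫|u|²)(∫|∇u|²))`. -/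
theorem weighted_vorticity_convection_estimate (δ : ℝ) (hδ : 0 < δ) :
    ∃ C > 0, ∀ t : ℝ, 0 ≤ t →
      ∀ u : EuclideanSpace ℝ (Fin 2) → EuclideanSpace ℝ (Fin 2),
        ContDiff ℝ (⊤ : ℕ∞) u → HasCompactSupport u →
        (∀ x, pd 0 (fun y => u y 0) x + pd 1 (fun y => u y 1) x = 0) →
        |∫ x, ψ t x ^ 2 * curl2 u x * ∑ k : Fin 2, u x k * pd k (curl2 u) x| ≤
          δ * (∫ x, ψ t x ^ 2 * curl2 u x ^ 2) +
          δ * (∫ x, ψ t x ^ 2 * ∑ i : Fin 2, pd i (curl2 u) x ^ 2) +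
          C * (1 + (∫ x, curl2 u x ^ 2) ^ 2 +
            (∫ x, ‖u x‖ ^ 2) *
              (∫ x, ∑ i : Fin 2, ∑ j : Fin 2, pd i (fun y => u y j) x ^ 2)) := by
  obtain ⟨K, hK, hlad⟩ := ladyzhenskaya
  refine ⟨2 * δ + K / (2 * δ), by positivity, fun t ht u hu huc hdiv => ?_⟩
  have hv (i : Fin 2) : ContDiff ℝ (⊤ : ℕ∞) (fun y => u y i) := contDiff_euclidean.1 hu i
  have hvc (i : Fin 2) : HasCompactSupport (fun y => u y i) :=
    huc.comp_left (g := fun z : E2 => z i) (by simp)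
  have hw : ContDiff ℝ 1 (curl2 u) :=
    ((contDiff_pd (hv 1) 0).sub (contDiff_pd (hv 0) 1)).of_le (by exact_mod_cast le_top)
  have hwc : HasCompactSupport (curl2 u) :=
    (hasCompactSupport_pd (hvc 1) 0).sub (hasCompactSupport_pd (hvc 0) 1)
  have hv1 (i : Fin 2) : ContDiff ℝ 1 (fun y => u y i) := (hv i).of_le (by exact_mod_cast le_top)
  have ha : ContDiff ℝ 1 (ψ t) := (contDiff_ψ t).of_le (by exact_mod_cast le_top)
  have hI := abs_integral_weighted_convection_le (v := fun i y => u y i) ha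
    (abs_pd_ψ_le ht) hw hwc hv1 hdiv
  have hgrad := integral_sq_pd_mul_le ha (abs_pd_ψ_le ht) hw hwc
  generalize curl2 u = w at *
  generalize ψ t = a at *
  have hac := ha.continuous
  have hwcont := hw.continuous
  have hvcont (i : Fin 2) := (hv1 i).continuous
  have hqc : HasCompactSupport (fun x => a x * w x) := hwc.mul_left
  have hX := hlad _ (ha.mul hw) hqc
  have hY := integral_abs_add_abs_pow_four_le (hvcont 0) (hvc 0) (hvcont 1) (hvc 1)
  have hC1 := sq_integral_mul_le (f := fun x => |w x|)
    (g := fun x => |a x * w x| * (|u x 0| + |u x 1|))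
    (by fun_prop) hwc.norm (by fun_prop) hqc.norm.mul_right
  have hC2 := sq_integral_mul_le (f := fun x => (a x * w x) ^ 2)
    (g := fun x => (|u x 0| + |u x 1|) ^ 2)
    (by fun_prop) (hasCompactSupport_pow hqc two_ne_zero) (by fun_prop)
    (hasCompactSupport_pow ((hvc 0).norm.add (hvc 1).norm) two_ne_zero)
  simp only [sq_abs, mul_pow |_| _ 2, ← pow_mul, Nat.reduceMul] at hC1 hC2
  have hsqi (i : Fin 2) : Integrable (fun x => u x i ^ 2) :=
    Continuous.integrable_of_hasCompactSupport (by fun_prop)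
      (hasCompactSupport_pow (hvc i) two_ne_zero)
  have hdi (i j : Fin 2) : Integrable (fun x => pd i (fun y => u y j) x ^ 2) :=
    Continuous.integrable_of_hasCompactSupport ((continuous_pd (hv1 j) i).pow 2)
      (hasCompactSupport_pow (hasCompactSupport_pd (hvc j) i) two_ne_zero)
  have hU : ∫ x, ‖u x‖ ^ 2 = (∫ x, u x 0 ^ 2) + ∫ x, u x 1 ^ 2 := by
    rw [← integral_add (hsqi 0) (hsqi 1)]
    simp [EuclideanSpace.norm_sq_eq]
  have hV : ∫ x, ∑ i : Fin 2, ∑ j : Fin 2, pd i (fun y => u y j) x ^ 2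
      = (∫ x, (pd 0 (fun y => u y 0) x ^ 2 + pd 1 (fun y => u y 0) x ^ 2))
        + ∫ x, (pd 0 (fun y => u y 1) x ^ 2 + pd 1 (fun y => u y 1) x ^ 2) := by
    have h := integral_add ((hdi 0 0).add (hdi 1 0)) ((hdi 0 1).add (hdi 1 1))
    simp only [Pi.add_apply] at h
    rw [← h]
    congr 1; ext x
    simp only [Fin.sum_univ_two]
    ring
  have hU0 (i : Fin 2) : 0 ≤ ∫ x, u x i ^ 2 := integral_nonneg fun x => by positivity
  have hV0 (j : Fin 2) : 0 ≤ ∫ x, (pd 0 (fun y => u y j) x ^ 2 + pd 1 (fun y => u y j) x ^ 2) :=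
    integral_nonneg fun x => by positivity
  have hl0 := hlad _ (hv1 0) (hvc 0)
  have hl1 := hlad _ (hv1 1) (hvc 1)
  have hA0 : 0 ≤ ∫ x, (a x * w x) ^ 2 := integral_nonneg fun x => by positivity
  have hB0 : 0 ≤ ∫ x, a x ^ 2 * ∑ i : Fin 2, pd i w x ^ 2 :=
    integral_nonneg fun x => by positivity
  have hW0 : 0 ≤ ∫ x, w x ^ 2 := integral_nonneg fun x => by positivity
  have hX0 : 0 ≤ ∫ x, (a x * w x) ^ 4 := integral_nonneg fun x => by positivity
  have hY0 : 0 ≤ ∫ x, (|u x 0| + |u x 1|) ^ 4 := integral_nonneg fun x => by positivity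
  rw [hU, hV]
  simp only [← mul_pow (a _) (w _) 2]
  have hYD : ∫ x, (|u x 0| + |u x 1|) ^ 4 ≤ 8 * (K * (((∫ x, u x 0 ^ 2) + ∫ x, u x 1 ^ 2) *
      ((∫ x, (pd 0 (fun y => u y 0) x ^ 2 + pd 1 (fun y => u y 0) x ^ 2))
        + ∫ x, (pd 0 (fun y => u y 1) x ^ 2 + pd 1 (fun y => u y 1) x ^ 2)))) := by
    nlinarith [mul_nonneg hK.le (mul_nonneg (hU0 0) (hV0 1)),
      mul_nonneg hK.le (mul_nonneg (hU0 1) (hV0 0))]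
  refine le_of_pow_four_le hδ hK hA0 hB0 hW0
    (mul_nonneg (add_nonneg (hU0 0) (hU0 1)) (add_nonneg (hV0 0) (hV0 1))) ?_
  refine (pow_le_pow_left₀ (abs_nonneg _) hI 4).trans ?_
  calc _ = ((∫ x, |w x| * (|a x * w x| * (|u x 0| + |u x 1|))) ^ 2) ^ 2 := by ring
    _ ≤ ((∫ x, w x ^ 2) * ∫ x, (a x * w x) ^ 2 * (|u x 0| + |u x 1|) ^ 2) ^ 2 := by gcongr
    _ = (∫ x, w x ^ 2) ^ 2 * (∫ x, (a x * w x) ^ 2 * (|u x 0| + |u x 1|) ^ 2) ^ 2 := by ring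
    _ ≤ (∫ x, w x ^ 2) ^ 2 * ((∫ x, (a x * w x) ^ 4) * ∫ x, (|u x 0| + |u x 1|) ^ 4) := by gcongr
    _ ≤ _ := by
      gcongr
      exact hX.trans (by gcongr)
end
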